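/- arXiv:1406.0576 — 5 statements merged into one kernel-verified Lean document; each statement's English description precedes it below -/
import Mathlib

section
/- For every allocation (S_1, …, S_n) in a combinatorial market, there exist a value v > 0 and a subset N* ⊆ {1, …, n} such that v_i(S_i) ∈ [v, 2v) for every i ∈ N*, and Σ_{i∈N*} v_i(S_i) ≥ (1 / (2(log(μ) + 2))) · Σ_{i=1}^n v_i(S_i), where μ = min{n, m}. -/
open Finset

/-- A combinatorial market with `n` consumers and `m` items. Each consumer has a
normalized (`v i ∅ = 0`) and monotone valuation over subsets of items. -/
structure Market (n m : ℕ) where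
  v : Fin n → Finset (Fin m) → ℝ
  v_empty : ∀ i, v i ∅ = 0
  v_mono : ∀ i, ∀ S T : Finset (Fin m), S ⊆ T → v i S ≤ v i T

/-- An allocation assigns pairwise disjoint sets of items to consumers. -/
def IsAllocation {n m : ℕ} (S : Fin n → Finset (Fin m)) : Prop :=
  ∀ i j : Fin n, i ≠ j → Disjoint (S i) (S j)

/-- The welfare of an allocation. -/
def allocWelfare {n m : ℕ} (Mk : Market n m) (S : Fin n → Finset (Fin m)) : ℝ :=
  ∑ i, Mk.v i (S i)

/-- The optimal welfare over all allocations. -/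
noncomputable def OPT {n m : ℕ} (Mk : Market n m) : ℝ :=
  sSup {w : ℝ | ∃ S : Fin n → Finset (Fin m), IsAllocation S ∧ allocWelfare Mk S = w}

/-- A competitive bundling equilibrium: a partition of the items into nonempty bundles,
nonnegative bundle prices, and an assignment of every bundle to a consumer (market
clearance), such that every consumer's assigned set of bundles maximizes his profit
over all sets of bundles. -/
structure CBE {n m : ℕ} (Mk : Market n m) where
  bundles : Finset (Finset (Fin m))
  price : Finset (Fin m) → ℝ
  assign : Finset (Fin m) → Fin n
  bundles_nonempty : ∀ b ∈ bundles, b.Nonempty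
  bundles_disjoint : ∀ b ∈ bundles, ∀ b' ∈ bundles, b ≠ b' → Disjoint b b'
  bundles_cover : bundles.biUnion id = Finset.univ
  price_nonneg : ∀ b ∈ bundles, 0 ≤ price b
  profit_max : ∀ i : Fin n, ∀ T : Finset (Finset (Fin m)), T ⊆ bundles →
    Mk.v i ((bundles.filter fun b => assign b = i).biUnion id)
        - ∑ b ∈ bundles.filter fun b => assign b = i, price b
      ≥ Mk.v i (T.biUnion id) - ∑ b ∈ T, price b

/-- The welfare of a competitive bundling equilibrium. -/
def CBE.welfare {n m : ℕ} {Mk : Market n m} (E : CBE Mk) : ℝ :=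
  ∑ i, Mk.v i ((E.bundles.filter fun b => E.assign b = i).biUnion id)

/-- The revenue of a competitive bundling equilibrium. -/
def CBE.revenue {n m : ℕ} {Mk : Market n m} (E : CBE Mk) : ℝ :=
  ∑ b ∈ E.bundles, E.price b

/-- A market is multi-unit if valuations depend only on the number of items. -/
def MultiUnit {n m : ℕ} (Mk : Market n m) : Prop :=
  ∀ i, ∀ S T : Finset (Fin m), S.card = T.card → Mk.v i S = Mk.v i T

/-- For every allocation there are a value `v > 0` and a subset `N*` of
consumers whose values all lie in `[v, 2v)` and which captures a
`1 / (2(log₂ μ + 2))`-fraction of the allocation's welfare. -/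
theorem logarithmic_binning (n m : ℕ) (hn : 1 ≤ n) (hm : 1 ≤ m) (Mk : Market n m)
    (S : Fin n → Finset (Fin m)) (hS : IsAllocation S) :
    ∃ (v : ℝ) (Nstar : Finset (Fin n)), 0 < v ∧
      (∀ i ∈ Nstar, Mk.v i (S i) ∈ Set.Ico v (2 * v)) ∧
      ∑ i ∈ Nstar, Mk.v i (S i) ≥
        (1 / (2 * (Real.logb 2 (min n m : ℕ) + 2))) * ∑ i, Mk.v i (S i) := by
  classical
  set a : Fin n → ℝ := fun i => Mk.v i (S i) with ha
  have a0 : ∀ i, 0 ≤ a i := fun i => by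
    have := Mk.v_mono i ∅ (S i) (Finset.empty_subset _)
    rwa [Mk.v_empty] at this
  set W : ℝ := ∑ i, a i with hW
  have hμ1 : 1 ≤ min n m := le_min hn hm
  set μ : ℕ := min n m with hμ
  have hW0 : 0 ≤ W := Finset.sum_nonneg fun i _ => a0 i
  rcases hW0.eq_or_lt with h0 | hWpos
  · refine ⟨1, ∅, one_pos, by simp, ?_⟩
    change ∑ i ∈ (∅ : Finset (Fin n)), a i ≥ _ * W
    rw [← h0]; simp
  have hμR : (1 : ℝ) ≤ μ := by exact_mod_cast hμ1
  have hμpos : (0 : ℝ) < μ := by linarith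
  set t : ℝ := W / (2 * μ) with ht
  have htpos : 0 < t := by positivity
  have htW : 2 * μ * t = W := by rw [ht]; field_simp
  set B : ℕ := Nat.log 2 μ + 2 with hB
  let P : Finset (Fin n) := univ.filter fun i => (S i).Nonempty
  have hP : P.card ≤ μ := by
    refine le_min ?_ ?_
    · simpa using Finset.card_le_univ P
    · have h1 : P.card ≤ (P.biUnion S).card := by
        apply Finset.card_le_card_biUnion
        · intro i _ j _ hij
          exact hS i j hij
        · intro i hi
          exact (Finset.mem_filter.mp hi).2
      exact h1.trans (by simpa using Finset.card_le_univ (P.biUnion S))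
  let N : ℕ → Finset (Fin n) := fun k =>
    univ.filter fun i => a i ∈ Set.Ico (t * 2 ^ k) (2 * (t * 2 ^ k))
  have key : ∀ i, a i ≤ (if i ∈ P then t else 0) +
      ∑ k ∈ range B, (if i ∈ N k then a i else 0) := by
    intro i
    have hs : 0 ≤ ∑ k ∈ range B, (if i ∈ N k then a i else 0) :=
      Finset.sum_nonneg fun k _ => by split_ifs; exacts [a0 i, le_rfl]
    by_cases hi : i ∈ P
    · rw [if_pos hi]
      rcases lt_or_ge (a i) t with hlt | hge
      · linarith
      · obtain ⟨k, hk1, hk2⟩ := exists_nat_pow_near (x := a i / t) (y := (2 : ℝ))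
          (by rwa [le_div_iff₀ htpos, one_mul]) one_lt_two
        rw [le_div_iff₀ htpos] at hk1
        rw [div_lt_iff₀ htpos, pow_succ] at hk2
        have haW : a i ≤ W := Finset.single_le_sum (fun j _ => a0 j) (Finset.mem_univ i)
        have h2 : (2 : ℝ) ^ k ≤ 2 * μ := by
          rw [← mul_le_mul_iff_left₀ htpos]; linarith
        have h3 : 2 ^ k ≤ μ * 2 := by
          have : 2 ^ k ≤ 2 * μ := by exact_mod_cast h2
          omega
        have hkB : k < B := by
          have := Nat.le_log_of_pow_le one_lt_two h3
          rw [Nat.log_mul_base one_lt_two (by omega)] at this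
          omega
        have hmem : i ∈ N k := by
          simp only [N, Finset.mem_filter, Finset.mem_univ, true_and, Set.mem_Ico]
          constructor <;> linarith
        have := Finset.single_le_sum (f := fun k => if i ∈ N k then a i else 0)
          (fun k _ => by split_ifs; exacts [a0 i, le_rfl]) (Finset.mem_range.mpr hkB)
        simp only [if_pos hmem] at this
        linarith
    · rw [if_neg hi]
      have : S i = ∅ := by
        simpa [P, Finset.not_nonempty_iff_eq_empty] using hi
      have h : a i = 0 := by
        simp only [ha, this, Mk.v_empty]
      linarith
  have hsum : W ≤ P.card * t + ∑ k ∈ range B, ∑ i ∈ N k, a i := by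
    calc W ≤ ∑ i, ((if i ∈ P then t else 0) + ∑ k ∈ range B, (if i ∈ N k then a i else 0)) :=
          Finset.sum_le_sum fun i _ => key i
      _ = _ := by
          rw [Finset.sum_add_distrib, Finset.sum_comm]
          simp [Finset.sum_ite_mem]
  have hPt : (P.card : ℝ) * t ≤ μ * t :=
    mul_le_mul_of_nonneg_right (by exact_mod_cast hP) htpos.le
  have hBpos : (0 : ℝ) < B := by
    have : 0 < B := by omega
    exact_mod_cast this
  obtain ⟨k, _, hk⟩ : ∃ k ∈ range B, W / (2 * B) ≤ ∑ i ∈ N k, a i := by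
    apply Finset.exists_le_of_sum_le (Finset.nonempty_range_iff.mpr (by omega))
    rw [Finset.sum_const, Finset.card_range, nsmul_eq_mul]
    have : (B : ℝ) * (W / (2 * B)) = W / 2 := by field_simp
    linarith
  have hlog : (B : ℝ) ≤ Real.logb 2 μ + 2 := by
    have h := Real.natLog_le_logb μ 2
    rw [hB]; push_cast at h ⊢
    linarith
  refine ⟨t * 2 ^ k, N k, by positivity, fun i hi => (Finset.mem_filter.mp hi).2, ?_⟩
  change _ * W ≤ ∑ i ∈ N k, a i
  refine le_trans ?_ hk
  rw [one_div_mul_eq_div]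
  gcongr
end

section
/- If a combinatorial market admits a non-linear pricing equilibrium, then it admits a competitive bundling equilibrium whose welfare equals the optimal welfare OPT. -/
open Finset

/-- A non-linear pricing equilibrium: an allocation together with nonnegative prices on
all bundles, satisfying profit maximization for every consumer and revenue maximization
over all alternative allocations. -/
def NonLinearPricingEquilibrium {n m : ℕ} (Mk : Market n m) : Prop :=
  ∃ (S : Fin n → Finset (Fin m)) (p : Finset (Fin m) → ℝ),
    IsAllocation S ∧ (∀ X : Finset (Fin m), 0 ≤ p X) ∧
    (∀ i, ∀ T : Finset (Fin m), Mk.v i (S i) - p (S i) ≥ Mk.v i T - p T) ∧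
    (∀ T : Fin n → Finset (Fin m), IsAllocation T → ∑ i, p (S i) ≥ ∑ i, p (T i))

theorem aux_union {n m : ℕ} (S : Fin n → Finset (Fin m)) (p : Finset (Fin m) → ℝ)
    (hS : IsAllocation S)
    (hr : ∀ T : Fin n → Finset (Fin m), IsAllocation T → ∑ i, p (S i) ≥ ∑ i, p (T i))
    (J : Finset (Fin n)) :
    p (J.biUnion S) - p ∅ ≤ ∑ j ∈ J, (p (S j) - p ∅) := by
  rcases J.eq_empty_or_nonempty with rfl | ⟨j0, hj0⟩
  · simp
  have hd : ∀ k, k ∉ J → Disjoint (J.biUnion S) (S k) := by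
    intro k hk
    rw [Finset.disjoint_biUnion_left]
    intro i hi
    exact hS i k (fun h => hk (h ▸ hi))
  let T : Fin n → Finset (Fin m) := fun k =>
    if k = j0 then J.biUnion S else if k ∈ J then ∅ else S k
  have hT : IsAllocation T := by
    intro i j hij
    have h1 := hd i
    have h2 := hd j
    have h3 := hS i j hij
    simp only [T]
    split_ifs with a b c d e f <;>
      first
        | exact Finset.disjoint_empty_left _
        | exact Finset.disjoint_empty_right _
        | exact absurd (a.trans b.symm) hij
        | exact h3
        | exact h2 (by assumption)
        | exact (h1 (by assumption)).symm
  have h := hr T hT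
  have e1 : ∀ f : Fin n → ℝ, ∑ i, f i = f j0 + ∑ i ∈ J.erase j0, f i + ∑ i ∈ Jᶜ, f i := by
    intro f
    rw [Finset.add_sum_erase J f hj0, Finset.sum_add_sum_compl]
  rw [e1, e1] at h
  have e2 : ∑ i ∈ J.erase j0, p (T i) = ∑ i ∈ J.erase j0, p ∅ := by
    refine Finset.sum_congr rfl fun i hi => ?_
    rw [Finset.mem_erase] at hi
    simp [T, hi.1, hi.2]
  have e3 : ∑ i ∈ Jᶜ, p (T i) = ∑ i ∈ Jᶜ, p (S i) := by
    refine Finset.sum_congr rfl fun i hi => ?_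
    rw [Finset.mem_compl] at hi
    have : i ≠ j0 := fun h => hi (h ▸ hj0)
    simp [T, hi, this]
  have e4 : T j0 = J.biUnion S := by simp [T]
  rw [e2, e3, e4] at h
  rw [← Finset.add_sum_erase J _ hj0, Finset.sum_sub_distrib]
  linarith

theorem aux_cover {n m : ℕ} (hn : 1 ≤ n) (Mk : Market n m)
    (h : NonLinearPricingEquilibrium Mk) :
    ∃ (S : Fin n → Finset (Fin m)) (p : Finset (Fin m) → ℝ),
    IsAllocation S ∧ (∀ x, ∃ i, x ∈ S i) ∧
    (∀ i, ∀ T : Finset (Fin m), Mk.v i (S i) - p (S i) ≥ Mk.v i T - p T) ∧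
    (∀ T : Fin n → Finset (Fin m), IsAllocation T → ∑ i, p (S i) ≥ ∑ i, p (T i)) := by
  obtain ⟨S, p, hS, -, hp, hr⟩ := h
  let j0 : Fin n := ⟨0, hn⟩
  let R : Finset (Fin m) := (Finset.univ.biUnion S)ᶜ
  have hR : ∀ i, Disjoint R (S i) := by
    intro i
    rw [Finset.disjoint_left]
    intro x hx hx'
    simp only [R, Finset.mem_compl, Finset.mem_biUnion, Finset.mem_univ, true_and,
      not_exists] at hx
    exact hx i hx'
  let S' : Fin n → Finset (Fin m) := Function.update S j0 (S j0 ∪ R)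
  have h0 : S' j0 = S j0 ∪ R := by simp [S']
  have h1 : ∀ i, i ≠ j0 → S' i = S i := fun i hi => by simp [S', hi]
  have hS' : IsAllocation S' := by
    intro i j hij
    by_cases hi : i = j0
    · have hj : j ≠ j0 := fun h => hij (hi.trans h.symm)
      rw [hi, h0, h1 j hj, Finset.disjoint_union_left]
      exact ⟨hS _ _ hj.symm, hR j⟩
    · rw [h1 i hi]
      by_cases hj : j = j0
      · rw [hj, h0, Finset.disjoint_union_right]
        exact ⟨hS _ _ hi, (hR i).symm⟩
      · rw [h1 j hj]
        exact hS _ _ hij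
  have hq := hr S' hS'
  have e1 : ∀ f : Fin n → ℝ, ∑ i, f i = f j0 + ∑ i ∈ Finset.univ.erase j0, f i := by
    intro f
    rw [Finset.add_sum_erase _ f (Finset.mem_univ _)]
  have e2 : ∑ i ∈ Finset.univ.erase j0, p (S' i) = ∑ i ∈ Finset.univ.erase j0, p (S i) :=
    Finset.sum_congr rfl fun i hi => by rw [h1 i (Finset.ne_of_mem_erase hi)]
  have hle : p (S' j0) ≤ p (S j0) := by
    rw [e1, e1, e2] at hq
    linarith
  have hv : Mk.v j0 (S j0) ≤ Mk.v j0 (S' j0) :=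
    Mk.v_mono _ _ _ (by rw [h0]; exact Finset.subset_union_left)
  have hd := hp j0 (S' j0)
  have heq : p (S' j0) = p (S j0) := by linarith
  refine ⟨S', p, hS', ?_, ?_, ?_⟩
  · intro x
    by_cases hx : ∃ i, x ∈ S i
    · obtain ⟨i, hi⟩ := hx
      refine ⟨i, ?_⟩
      by_cases hj : i = j0
      · rw [hj, h0]; exact Finset.mem_union_left _ (hj ▸ hi)
      · rwa [h1 i hj]
    · refine ⟨j0, ?_⟩
      rw [h0]
      apply Finset.mem_union_right
      simpa [R] using hx
  · intro i T
    by_cases hi : i = j0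
    · have := hp j0 T
      rw [hi]
      linarith
    · rw [h1 i hi]; exact hp i T
  · intro T hT
    have := hr T hT
    rw [e1, e2, heq, ← e1 (fun i => p (S i))]
    exact this

/-- If a market admits a non-linear pricing equilibrium, then it admits a
CBE whose welfare equals the optimal welfare. -/
theorem cbe_from_nlpe (n m : ℕ) (hn : 1 ≤ n) (hm : 1 ≤ m) (Mk : Market n m)
    (h : NonLinearPricingEquilibrium Mk) :
    ∃ E : CBE Mk, E.welfare = OPT Mk := by
  classical
  obtain ⟨S, p, hS, hc, hp, hr⟩ := aux_cover hn Mk h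
  have hU := aux_union S p hS hr
  have hinj : ∀ i j, (S i).Nonempty → S i = S j → i = j := by
    intro i j hi hij
    by_contra hne
    have := hS i j hne
    rw [← hij, disjoint_self] at this
    exact hi.ne_empty this
  let j0 : Fin n := ⟨0, hn⟩
  let B : Finset (Finset (Fin m)) := (Finset.univ.image S).filter fun b => b.Nonempty
  let a : Finset (Fin m) → Fin n := fun b => if hb : ∃ i, S i = b then hb.choose else j0
  have ha : ∀ i, (S i).Nonempty → a (S i) = i := by
    intro i hi
    have hb : ∃ j, S j = S i := ⟨i, rfl⟩
    have : a (S i) = hb.choose := dif_pos hb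
    rw [this]
    exact (hinj _ _ hi hb.choose_spec.symm).symm
  have hB : ∀ b, b ∈ B ↔ b.Nonempty ∧ ∃ i, S i = b := by
    intro b
    simp [B, and_comm]
  have hF : ∀ i, (B.filter fun b => a b = i) = if (S i).Nonempty then {S i} else ∅ := by
    intro i
    ext b
    rw [Finset.mem_filter, hB]
    constructor
    · rintro ⟨⟨hb, j, rfl⟩, hj⟩
      rw [ha j hb] at hj
      subst hj
      simp [hb]
    · intro hb
      split_ifs at hb with hi
      · rw [Finset.mem_singleton] at hb
        subst hb
        exact ⟨⟨hi, i, rfl⟩, ha i hi⟩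
      · simp at hb
  have hFu : ∀ i, (B.filter fun b => a b = i).biUnion id = S i := by
    intro i
    rw [hF]
    split_ifs with hi
    · simp
    · rw [Finset.not_nonempty_iff_eq_empty] at hi
      simp [hi]
  have hFs : ∀ i, ∑ b ∈ B.filter (fun b => a b = i), (p b - p ∅) = p (S i) - p ∅ := by
    intro i
    rw [hF]
    split_ifs with hi
    · simp
    · rw [Finset.not_nonempty_iff_eq_empty] at hi
      simp [hi]
  have hT : ∀ T ⊆ B, p (T.biUnion id) - p ∅ ≤ ∑ b ∈ T, (p b - p ∅) := by
    intro T hTB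
    have hTe : T = (Finset.univ.filter fun k => S k ∈ T).image S := by
      ext b
      simp only [Finset.mem_image, Finset.mem_filter, Finset.mem_univ, true_and]
      constructor
      · intro hb
        obtain ⟨-, i, rfl⟩ := (hB b).1 (hTB hb)
        exact ⟨i, hb, rfl⟩
      · rintro ⟨i, hi, rfl⟩
        exact hi
    have := hU (Finset.univ.filter fun k => S k ∈ T)
    have e1 : T.biUnion id = (Finset.univ.filter fun k => S k ∈ T).biUnion S := by
      conv_lhs => rw [hTe]
      rw [Finset.image_biUnion]
      rfl
    have e2 : ∑ b ∈ T, (p b - p ∅) =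
        ∑ j ∈ Finset.univ.filter fun k => S k ∈ T, (p (S j) - p ∅) := by
      conv_lhs => rw [hTe]
      rw [Finset.sum_image]
      intro i hi j _ hij
      have hi' : S i ∈ T := by simpa using hi
      exact hinj i j ((hB _).1 (hTB hi')).1 hij
    rw [e1, e2]
    exact this
  refine ⟨⟨B, fun b => p b - p ∅, a, fun b hb => ((hB b).1 hb).1, ?_, ?_, ?_, ?_⟩, ?_⟩
  · intro b hb b' hb' hne
    obtain ⟨-, i, rfl⟩ := (hB b).1 hb
    obtain ⟨-, j, rfl⟩ := (hB b').1 hb'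
    exact hS i j (fun h => hne (h ▸ rfl))
  · ext x
    obtain ⟨i, hi⟩ := hc x
    simp only [Finset.mem_biUnion, Finset.mem_univ, iff_true]
    exact ⟨S i, (hB _).2 ⟨⟨x, hi⟩, i, rfl⟩, hi⟩
  · intro b hb
    obtain ⟨-, i, rfl⟩ := (hB b).1 hb
    -- replacing `S i` by the empty set cannot raise revenue
    have hA : IsAllocation (Function.update S i ∅) := by
      intro k l hkl
      by_cases hk : k = i
      · subst hk; simp
      · by_cases hl : l = i
        · subst hl; simp
        · simpa [hk, hl] using hS k l hkl
    have h1 := hr _ hA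
    rw [← Finset.add_sum_erase _ _ (Finset.mem_univ i),
      ← Finset.add_sum_erase _ (fun k => p (Function.update S i ∅ k)) (Finset.mem_univ i)] at h1
    have e : ∑ k ∈ Finset.univ.erase i, p (Function.update S i ∅ k) =
        ∑ k ∈ Finset.univ.erase i, p (S k) :=
      Finset.sum_congr rfl fun k hk => by
        rw [Function.update_of_ne (Finset.ne_of_mem_erase hk)]
    rw [e, Function.update_self] at h1
    linarith
  · intro i T hTB
    have h1 := hT T hTB
    have h2 := hp i (T.biUnion id)
    have h3 := hFs i
    have h4 := hFu i
    simp only [h4, h3]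
    linarith
  · have hw : ∀ T, IsAllocation T → allocWelfare Mk T ≤ allocWelfare Mk S := by
      intro T hT
      have h1 := hr T hT
      have h2 := Finset.sum_le_sum (s := Finset.univ) fun i _ => hp i (T i)
      simp only [Finset.sum_sub_distrib] at h2
      unfold allocWelfare
      linarith
    have hopt : OPT Mk = allocWelfare Mk S := by
      apply IsGreatest.csSup_eq
      refine ⟨⟨S, hS, rfl⟩, ?_⟩
      rintro w ⟨T, hT, rfl⟩
      exact hw T hT
    rw [hopt]
    unfold CBE.welfare allocWelfare
    exact Finset.sum_congr rfl fun i _ => congrArg _ (hFu i)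
end

section
/- Consider the combinatorial market with 2 consumers and 2 items a, b, where consumer 1's valuation is v_1({a}) = v_1({b}) = 0 and v_1({a,b}) = 8, and consumer 2's valuation is v_2(S) = 7 for every nonempty S ⊆ {a,b} (and v_2(∅) = 0). This market admits a competitive bundling equilibrium whose welfare equals OPT = 8, yet it admits no non-linear pricing equilibrium. -/
open Finset

theorem finset_fin_two_cases (S : Finset (Fin 2)) :
    S = ∅ ∨ S = {0} ∨ S = {1} ∨ S = {0, 1} := by
  revert S; decide

/-- The two-item market where consumer 1 values only the grand bundle
(at 8) and consumer 2 is unit-demand with value 7 admits an efficient CBE with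
`OPT = 8`, but admits no non-linear pricing equilibrium. -/
theorem efficient_cbe_without_nlpe (Mk : Market 2 2)
    (h10 : Mk.v 0 {0} = 0) (h11 : Mk.v 0 {1} = 0) (h1ab : Mk.v 0 {0, 1} = 8)
    (h2 : ∀ S : Finset (Fin 2), S.Nonempty → Mk.v 1 S = 7) :
    (∃ E : CBE Mk, E.welfare = 8) ∧ OPT Mk = 8 ∧ ¬ NonLinearPricingEquilibrium Mk := by
  have e0 := Mk.v_empty 0
  have e1 := Mk.v_empty 1
  have a0 : Mk.v 1 {0} = 7 := h2 _ (by simp)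
  have a1 : Mk.v 1 {1} = 7 := h2 _ (by simp)
  have a2 : Mk.v 1 {0, 1} = 7 := h2 _ (by simp)
  have halloc : ∀ A B : Finset (Fin 2), Disjoint A B →
      IsAllocation (![A, B] : Fin 2 → Finset (Fin 2)) := by
    intro A B h i j hij
    fin_cases i <;> fin_cases j <;> simp_all [disjoint_comm]
  -- every allocation other than `({a,b}, ∅)` has welfare at most `7`
  have hw : ∀ S : Fin 2 → Finset (Fin 2), IsAllocation S →
      (S 0 = {0, 1} ∧ S 1 = ∅) ∨ Mk.v 0 (S 0) + Mk.v 1 (S 1) ≤ 7 := by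
    intro S hS
    have hd := hS 0 1 (by decide)
    generalize S 0 = A at *
    generalize S 1 = B at *
    rcases finset_fin_two_cases A with rfl | rfl | rfl | rfl
    · right
      rcases finset_fin_two_cases B with rfl | rfl | rfl | rfl <;> linarith
    · right
      rcases finset_fin_two_cases B with rfl | rfl | rfl | rfl <;> linarith
    · right
      rcases finset_fin_two_cases B with rfl | rfl | rfl | rfl <;> linarith
    · left
      refine ⟨rfl, ?_⟩
      rcases finset_fin_two_cases B with rfl | rfl | rfl | rfl
      · rfl
      all_goals exact absurd hd (by decide)
  have hf0 : (({({0, 1} : Finset (Fin 2))} : Finset (Finset (Fin 2))).filter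
      fun _ => (0 : Fin 2) = 0) = {{0, 1}} := by decide
  have hf1 : (({({0, 1} : Finset (Fin 2))} : Finset (Finset (Fin 2))).filter
      fun _ => (0 : Fin 2) = 1) = ∅ := by decide
  refine ⟨⟨⟨{{0, 1}}, fun _ => 8, fun _ => 0, by simp, ?_, by decide, by simp, ?_⟩, ?_⟩, ?_, ?_⟩
  · intro b hb b' hb' hne
    rw [Finset.mem_singleton] at hb hb'
    exact absurd (hb.trans hb'.symm) hne
  · intro i T hT
    rcases Finset.subset_singleton_iff.mp hT with rfl | rfl
    · fin_cases i
      · simp only [Fin.zero_eta, hf0]; simp [h1ab, e0]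
      · simp only [Fin.mk_one, hf1]; simp [e1]
    · fin_cases i
      · simp only [Fin.zero_eta, hf0]; simp [h1ab]
      · simp only [Fin.mk_one, hf1]; simp [e1, a2]; norm_num
  · simp only [CBE.welfare, Fin.sum_univ_two, hf0, hf1]
    simp [h1ab, e1]
  · apply IsGreatest.csSup_eq
    constructor
    · exact ⟨![{0, 1}, ∅], halloc _ _ (by simp), by simp [allocWelfare, h1ab, e1]⟩
    · rintro w ⟨S, hS, rfl⟩
      simp only [allocWelfare, Fin.sum_univ_two]
      rcases hw S hS with ⟨h, h'⟩ | h
      · rw [h, h']; linarith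
      · linarith
  · rintro ⟨S, p, hS, -, hprof, hrev⟩
    have r1 := hrev _ (halloc {0, 1} ∅ (by simp))
    have r2 := hrev _ (halloc {0} {1} (by simp))
    simp only [Fin.sum_univ_two, Matrix.cons_val_zero, Matrix.cons_val_one] at r1 r2
    have p1 := hprof 0 {0, 1}
    have p2 := hprof 1 ∅
    have p3 := hprof 0 ∅
    have p4 := hprof 1 {0}
    have p5 := hprof 1 {1}
    rcases hw S hS with ⟨h, h'⟩ | h
    · simp only [h, h'] at r1 r2 p1 p2 p3 p4 p5
      linarith
    · linarith
end

section
/- Let n ≥ 2 be an integer and let α ∈ [0, 1]. Suppose real numbers (x_i, p_i) for i = 2, …, n satisfy 0 ≤ x_i ≤ 1 − α, p_i ≥ 0, individual rationality x_i/i − p_i ≥ 0, and incentive compatibility x_i/i − p_i ≥ x_j/i − p_j for all i, j ∈ {2, …, n}. Then Σ_{i=2}^n p_i ≤ 1 − α. -/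
/-- The key revenue bound for the lotteries lower bound. A single item is
sold to a single bidder with value uniform on `{1/2, …, 1/n}`; a truthful,
individually rational menu `(x_i, p_i)` with allocation probabilities at most `1 - α`
yields total payment at most `1 - α`. -/
theorem menu_revenue_bound (n : ℕ) (hn : 2 ≤ n) (α : ℝ) (hα0 : 0 ≤ α) (hα1 : α ≤ 1)
    (x p : ℕ → ℝ)
    (hx0 : ∀ i ∈ Finset.Icc 2 n, 0 ≤ x i)
    (hx1 : ∀ i ∈ Finset.Icc 2 n, x i ≤ 1 - α)
    (hp : ∀ i ∈ Finset.Icc 2 n, 0 ≤ p i)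
    (hIR : ∀ i ∈ Finset.Icc 2 n, 0 ≤ x i / (i : ℝ) - p i)
    (hIC : ∀ i ∈ Finset.Icc 2 n, ∀ j ∈ Finset.Icc 2 n,
      x i / (i : ℝ) - p i ≥ x j / (i : ℝ) - p j) :
    ∑ i ∈ Finset.Icc 2 n, p i ≤ 1 - α := by
  have key : ∀ k : ℕ, 2 ≤ k → k ≤ n →
      ∑ i ∈ Finset.Icc 2 k, p i ≤ ((k : ℝ) - 1) * p k + x 2 - x k := by
    intro k hk
    induction k, hk using Nat.le_induction with
    | base => intro _; norm_num
    | succ k hk ih =>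
      intro hkn
      have ih' := ih (by omega)
      rw [Finset.sum_Icc_succ_top (by omega)]
      have hk1 : k ∈ Finset.Icc 2 n := Finset.mem_Icc.2 ⟨hk, by omega⟩
      have hk2 : k + 1 ∈ Finset.Icc 2 n := Finset.mem_Icc.2 ⟨by omega, hkn⟩
      have h1 := hIC k hk1 (k + 1) hk2
      have h2 := hIC (k + 1) hk2 k hk1
      have hkpos : (0 : ℝ) < k := by exact_mod_cast (by omega : 0 < k)
      push_cast at h2 ⊢
      have e1 : (p k - p (k + 1)) * k ≤ x k - x (k + 1) := by
        rw [← le_div_iff₀ hkpos, sub_div]; linarith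
      have e2 : x k - x (k + 1) ≤ (p k - p (k + 1)) * (k + 1) := by
        rw [← div_le_iff₀ (by linarith), sub_div]; linarith
      linarith
  have hnn : n ∈ Finset.Icc 2 n := Finset.mem_Icc.2 ⟨hn, le_refl n⟩
  have h1 := key n hn le_rfl
  have h2 := hIR n hnn
  have h3 := hp n hnn
  have h4 := hx1 2 (Finset.mem_Icc.2 ⟨le_rfl, hn⟩)
  have hnpos : (0 : ℝ) < n := by exact_mod_cast (by omega : 0 < n)
  have h5 : p n * n ≤ x n := by
    rw [← le_div_iff₀ hnpos]; linarith
  linarith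
end

section
/- Every combinatorial market in which every consumer's valuation is superadditive admits a competitive bundling equilibrium whose welfare equals the optimal welfare OPT. -/
open Finset

/-- The items sent to consumer `i` by `f`. -/
def fib {n m : ℕ} (f : Fin m → Fin n) (i : Fin n) : Finset (Fin m) :=
  univ.filter fun x => f x = i

theorem mem_fib {n m : ℕ} (f : Fin m → Fin n) (i : Fin n) (x : Fin m) :
    x ∈ fib f i ↔ f x = i := by simp [fib]

theorem key {n m : ℕ} (Mk : Market n m)
    (hsuper : ∀ i, ∀ S T : Finset (Fin m), Disjoint S T →
      Mk.v i S + Mk.v i T ≤ Mk.v i (S ∪ T))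
    (f : Fin m → Fin n)
    (hf : ∀ g : Fin m → Fin n, ∑ i, Mk.v i (fib g i) ≤ ∑ i, Mk.v i (fib f i))
    (i : Fin n) (I : Finset (Fin n)) :
    Mk.v i (univ.filter fun x => f x ∈ I) ≤ ∑ k ∈ I, Mk.v k (fib f k) := by
  set U := univ.filter fun x => f x ∈ I with hU
  have h := hf (fun x => if f x ∈ I then i else f x)
  set g : Fin m → Fin n := fun x => if f x ∈ I then i else f x with hg
  have hp : ∀ k ∈ (univ : Finset (Fin n)), Mk.v k (fib f k) + (if k = i then Mk.v i U else 0)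
      ≤ Mk.v k (fib g k) + (if k ∈ I then Mk.v k (fib f k) else 0) := by
    intro k _
    by_cases hk : k = i
    · subst hk
      by_cases hI : k ∈ I
      · have : U ⊆ fib g k := by
          intro x hx
          simp only [hU, mem_filter, mem_univ, true_and] at hx
          simp [mem_fib, hg, hx]
        have := Mk.v_mono k _ _ this
        simp only [hI, if_true]
        linarith
      · have hd : Disjoint (fib f k) U := by
          rw [Finset.disjoint_left]
          intro x hx hx'
          rw [mem_fib] at hx
          simp only [hU, mem_filter, mem_univ, true_and] at hx'
          exact hI (hx ▸ hx')
        have h1 := hsuper k _ _ hd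
        have : fib f k ∪ U ⊆ fib g k := by
          intro x hx
          simp only [hU, mem_union, mem_fib, mem_filter, mem_univ, true_and] at hx
          simp only [mem_fib, hg]
          split_ifs <;> tauto
        have := Mk.v_mono k _ _ this
        simp only [hI, if_true, if_false]
        linarith
    · by_cases hI : k ∈ I
      · have := Mk.v_mono k ∅ (fib g k) (by simp)
        rw [Mk.v_empty] at this
        simp only [hk, hI, if_true, if_false]
        linarith
      · have : fib f k ⊆ fib g k := by
          intro x hx
          simp only [mem_fib] at hx
          subst hx
          simp [mem_fib, hg, hI]
        have := Mk.v_mono k _ _ this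
        simp only [hk, hI, if_false]
        linarith
  have h2 := Finset.sum_le_sum hp
  simp only [sum_add_distrib, Finset.sum_ite_eq', mem_univ, if_true, Finset.sum_ite_mem,
    univ_inter] at h2
  linarith

/-- Every market with superadditive valuations admits a CBE whose welfare
equals the optimal welfare. -/
theorem superadditive_efficient_cbe (n m : ℕ) (hn : 1 ≤ n) (hm : 1 ≤ m)
    (Mk : Market n m)
    (hsuper : ∀ i, ∀ S T : Finset (Fin m), Disjoint S T →
      Mk.v i S + Mk.v i T ≤ Mk.v i (S ∪ T)) :
    ∃ E : CBE Mk, E.welfare = OPT Mk := by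
  classical
  haveI : NeZero n := ⟨by omega⟩
  obtain ⟨f, hf⟩ := Finite.exists_max (fun g : Fin m → Fin n => ∑ i, Mk.v i (fib g i))
  have hOPT : OPT Mk = ∑ i, Mk.v i (fib f i) := by
    apply IsGreatest.csSup_eq
    constructor
    · refine ⟨fib f, ?_, rfl⟩
      intro i j hij
      rw [Finset.disjoint_left]
      intro x hx hx'
      rw [mem_fib] at hx hx'
      exact hij (hx.symm.trans hx')
    · rintro w ⟨S, hS, rfl⟩
      refine le_trans ?_ (hf (fun x => if h : ∃ i, x ∈ S i then h.choose else 0))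
      apply Finset.sum_le_sum
      intro i _
      apply Mk.v_mono
      intro x hx
      have h : ∃ i, x ∈ S i := ⟨i, hx⟩
      simp only [mem_fib, h, dif_pos]
      by_contra hne
      exact Finset.disjoint_left.1 (hS _ _ hne) h.choose_spec hx
  let asg : Finset (Fin m) → Fin n := fun b => if h : b.Nonempty then f h.choose else 0
  have hasg : ∀ i, (fib f i).Nonempty → asg (fib f i) = i := by
    intro i h
    simp only [asg, h, dif_pos]
    exact (mem_fib _ _ _).1 h.choose_spec
  let B : Finset (Finset (Fin m)) := (univ.image (fib f)).filter fun b => b.Nonempty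
  have hB : ∀ b ∈ B, b.Nonempty ∧ b = fib f (asg b) := by
    intro b hb
    simp only [B, mem_filter, mem_image, mem_univ, true_and] at hb
    obtain ⟨⟨i, rfl⟩, h⟩ := hb
    exact ⟨h, by rw [hasg i h]⟩
  have hB' : ∀ i, (fib f i).Nonempty → fib f i ∈ B := by
    intro i h
    simp only [B, mem_filter, mem_image, mem_univ, true_and]
    exact ⟨⟨i, rfl⟩, h⟩
  have hfilt : ∀ i, (B.filter fun b => asg b = i) =
      if (fib f i).Nonempty then {fib f i} else ∅ := by
    intro i
    ext b
    rw [mem_filter]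
    constructor
    · rintro ⟨hb, rfl⟩
      have := hB b hb
      rw [← this.2, if_pos this.1, mem_singleton]
    · intro h
      split_ifs at h with h1
      · rw [mem_singleton] at h
        subst h
        exact ⟨hB' i h1, hasg i h1⟩
      · simp at h
  have hun : ∀ i, (B.filter fun b => asg b = i).biUnion id = fib f i := by
    intro i
    rw [hfilt]
    split_ifs with h
    · simp
    · rw [Finset.not_nonempty_iff_eq_empty] at h
      simp [h]
  have hsum : ∀ i, ∑ b ∈ B.filter (fun b => asg b = i), Mk.v (asg b) b = Mk.v i (fib f i) := by
    intro i
    rw [hfilt]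
    split_ifs with h
    · simp [hasg i h]
    · rw [Finset.not_nonempty_iff_eq_empty] at h
      simp [h, Mk.v_empty]
  refine ⟨⟨B, fun b => Mk.v (asg b) b, asg, fun b hb => (hB b hb).1, ?_, ?_, ?_, ?_⟩, ?_⟩
  · intro b hb b' hb' hne
    rw [Finset.disjoint_left]
    intro x hx hx'
    have e := (hB b hb).2
    have e' := (hB b' hb').2
    rw [e, mem_fib] at hx
    rw [e', mem_fib] at hx'
    exact hne (by rw [e, e', ← hx, ← hx'])
  · ext x
    simp only [mem_biUnion, mem_univ, iff_true, id]
    have hx : x ∈ fib f (f x) := by rw [mem_fib]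
    exact ⟨_, hB' _ ⟨x, hx⟩, hx⟩
  · intro b _
    have := Mk.v_mono (asg b) ∅ b (by simp)
    rwa [Mk.v_empty] at this
  · intro i T hT
    rw [hun, hsum, sub_self, ge_iff_le, sub_nonpos]
    have hk := key Mk hsuper f hf i (T.image asg)
    have e1 : (univ.filter fun x => f x ∈ T.image asg) = T.biUnion id := by
      ext x
      simp only [mem_filter, mem_univ, true_and, mem_image, mem_biUnion, id]
      constructor
      · rintro ⟨b, hb, h⟩
        refine ⟨b, hb, ?_⟩
        rw [(hB b (hT hb)).2, mem_fib, h]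
      · rintro ⟨b, hb, h⟩
        refine ⟨b, hb, ?_⟩
        rw [(hB b (hT hb)).2, mem_fib] at h
        exact h.symm
    have e2 : ∑ k ∈ T.image asg, Mk.v k (fib f k) = ∑ b ∈ T, Mk.v (asg b) b := by
      rw [Finset.sum_image]
      · apply Finset.sum_congr rfl
        intro b hb
        rw [← (hB b (hT hb)).2]
      · intro b hb b' hb' h
        rw [(hB b (hT hb)).2, (hB b' (hT hb')).2, h]
    rw [e1, e2] at hk
    exact hk
  · rw [hOPT]
    simp only [CBE.welfare]
    exact Finset.sum_congr rfl fun i _ => by rw [← hun i]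
end
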